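/- arXiv:1610.04353 — 3 statements merged into one kernel-verified Lean document; each statement's English description precedes it below -/
import Mathlib

section
/- Let h_1,…,h_n ∈ ℤ_{≥0} with H = h_1+⋯+h_n, and set d = max_{1≤i≤n}(h_i+1)(H−h_i) + 1. Then (y_1^{(h_1)}·y_2^{(h_2)}⋯y_n^{(h_n)})^d belongs to the differential ideal [y_1⋯y_n], i.e., to the ideal generated by all derivatives D^k(y_1⋯y_n), k ∈ ℤ_{≥0}. -/
open MvPolynomial

namespace SeriesProduct

section

variable {K R : Type*} [Field K] [CommRing R] [Algebra K R]

/-- The product of the series `F(c t)` for `c` in a multiset. -/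
noncomputable def dilationProd (F : PowerSeries R) (Y : Multiset K) : PowerSeries R :=
  (Y.map fun c => PowerSeries.rescale (algebraMap K R c) F).prod

lemma dilationProd_zero (F : PowerSeries R) : dilationProd F (0 : Multiset K) = 1 := by
  simp [dilationProd]

lemma dilationProd_cons (F : PowerSeries R) (c : K) (Y : Multiset K) :
    dilationProd F (c ::ₘ Y) =
      PowerSeries.rescale (algebraMap K R c) F * dilationProd F Y := by
  simp [dilationProd]

lemma dual_coeff_rescale_mul (φ : R →ₗ[K] K) (F G : PowerSeries R) (c : K) (w : ℕ) :
    φ (PowerSeries.coeff w (PowerSeries.rescale (algebraMap K R c) F * G)) =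
      ∑ k ∈ Finset.range (w + 1),
        c ^ k * φ (PowerSeries.coeff k F * PowerSeries.coeff (w - k) G) := by
  rw [PowerSeries.coeff_mul, Finset.Nat.sum_antidiagonal_eq_sum_range_succ
    (fun i j => PowerSeries.coeff i (PowerSeries.rescale (algebraMap K R c) F) *
      PowerSeries.coeff j G), map_sum]
  refine Finset.sum_congr rfl fun k _ => ?_
  rw [PowerSeries.coeff_rescale, ← map_pow, mul_assoc, ← Algebra.smul_def, map_smul, smul_eq_mul]

lemma dual_coeff_mul_eq_zero (φ : R →ₗ[K] K) (F G : PowerSeries R) (w : ℕ) (S : Finset K)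
    (hS : ∀ c ∈ S,
      φ (PowerSeries.coeff w (PowerSeries.rescale (algebraMap K R c) F * G)) = 0)
    (htop : ∀ k ≤ w, S.card ≤ k →
      φ (PowerSeries.coeff k F * PowerSeries.coeff (w - k) G) = 0)
    (k : ℕ) (hk : k ≤ w) :
    φ (PowerSeries.coeff k F * PowerSeries.coeff (w - k) G) = 0 := by
  by_cases hkS : S.card ≤ k
  · exact htop k hk hkS
  set p : Polynomial K := ∑ k ∈ Finset.range (w + 1),
    Polynomial.monomial k (φ (PowerSeries.coeff k F * PowerSeries.coeff (w - k) G)) with hp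
  have hcoeff : ∀ j, p.coeff j = if j ≤ w then
      φ (PowerSeries.coeff j F * PowerSeries.coeff (w - j) G) else 0 := by
    intro j
    simp [hp, Polynomial.coeff_monomial]
  have hp0 : p = 0 := by
    refine Polynomial.eq_zero_of_natDegree_lt_card_of_eval_eq_zero' p S ?_ ?_
    · intro c hc
      rw [← hS c hc, dual_coeff_rescale_mul, hp, Polynomial.eval_finsetSum]
      exact Finset.sum_congr rfl fun k _ => by rw [Polynomial.eval_monomial, mul_comm]
    · refine lt_of_le_of_lt (b := S.card - 1) ?_ (by omega)
      rw [Polynomial.natDegree_le_iff_coeff_eq_zero]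
      intro j hj
      rw [hcoeff]
      split_ifs with h
      · exact htop j h (by omega)
      · rfl
  have := hcoeff k
  rwa [hp0, Polynomial.coeff_zero, if_pos hk, eq_comm] at this

lemma dual_coeff_mul_eq_zero_of_forall [Infinite K] (φ : R →ₗ[K] K) (F G : PowerSeries R) (w : ℕ)
    (h : ∀ c : K, φ (PowerSeries.coeff w (PowerSeries.rescale (algebraMap K R c) F * G)) = 0)
    (k : ℕ) (hk : k ≤ w) :
    φ (PowerSeries.coeff k F * PowerSeries.coeff (w - k) G) = 0 := by
  obtain ⟨S, hS⟩ := Infinite.exists_subset_card_eq K (w + 1)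
  exact dual_coeff_mul_eq_zero φ F G w S (fun c _ => h c) (fun j hj h' => by omega) k hk

/-- `Vanishes` expresses that `φ` kills the coefficient of `t^w` of the products attached to `m`
dilations of `F` and a member of the family `G`, as soon as `s` values occur in that member
and `r` of them occur among the dilation factors. -/
def Vanishes {τ : Type*} (F : PowerSeries R) (G : τ → PowerSeries R) (V : τ → Set K)
    (φ : R →ₗ[K] K) (w m r s : ℕ) : Prop :=
  ∀ (Y : Multiset K) (x : τ) (T U : Finset K), Y.card = m → U ⊆ T → T.card = s → U.card = r →
    (∀ t ∈ T, t ∈ V x) → (∀ u ∈ U, u ∈ Y) →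
    φ (PowerSeries.coeff w (dilationProd F Y * G x)) = 0

lemma exists_leading_dual [Infinite K] {τ : Type*} (F : PowerSeries R) (G : τ → PowerSeries R) (V : τ → Set K)
    (m : ℕ) (φ : R →ₗ[K] K) (w : ℕ)
    (hne : ∃ (Y : Multiset K) (x : τ), Y.card = m ∧
      φ (PowerSeries.coeff w (dilationProd F Y * G x)) ≠ 0) :
    ∃ (ψ : R →ₗ[K] K) (w' E : ℕ), w = w' + E ∧ (∃ x, ψ (PowerSeries.coeff w' (G x)) ≠ 0) ∧
      ∀ r s, Vanishes F G V φ w m r s →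
        Vanishes F G V ψ w' 0 0 s ∨ (1 ≤ r ∧ (m + 1 - r) * (s + 1 - r) ≤ E) := by
  classical
  induction m generalizing φ w with
  | zero =>
    obtain ⟨Y, x, hY, hx⟩ := hne
    rw [Multiset.card_eq_zero] at hY
    subst hY
    refine ⟨φ, w, 0, rfl, ⟨x, by simpa [dilationProd_zero] using hx⟩, fun r s h => ?_⟩
    rcases Nat.eq_zero_or_pos r with rfl | hr
    · exact Or.inl h
    · exact Or.inr ⟨hr, by simp [show 0 + 1 - r = 0 by omega]⟩
  | succ m ih =>
    obtain ⟨Y, x, hY, hx⟩ := hne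
    obtain ⟨c, Y, rfl⟩ := Multiset.card_pos_iff_exists_mem.1 (by omega : 0 < Y.card) |>.imp
      fun c hc => Multiset.exists_cons_of_mem hc
    rw [Multiset.card_cons, Nat.add_right_cancel_iff] at hY
    let P : ℕ → Prop := fun e => ∃ (Y : Multiset K) (x : τ), Y.card = m ∧
      φ (PowerSeries.coeff e F * PowerSeries.coeff (w - e) (dilationProd F Y * G x)) ≠ 0
    have hP : ∃ e ≤ w, P e := by
      by_contra! hcon
      apply hx
      rw [dilationProd_cons, mul_assoc, dual_coeff_rescale_mul]
      refine Finset.sum_eq_zero fun k hk => ?_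
      have := hcon k (by simpa [Nat.lt_succ_iff] using hk)
      simp only [P, not_exists, not_and, not_not] at this
      rw [this Y x hY, mul_zero]
    obtain ⟨e₀, he₀, hPe₀⟩ := hP
    set e := Nat.findGreatest P w with he
    have hPe : P e := Nat.findGreatest_spec he₀ hPe₀
    have hew : e ≤ w := Nat.findGreatest_le w
    have hmax : ∀ k ≤ w, e + 1 ≤ k → ∀ (Y : Multiset K) (x : τ), Y.card = m →
        φ (PowerSeries.coeff k F * PowerSeries.coeff (w - k) (dilationProd F Y * G x)) = 0 := by
      intro k hk hek Y x hY
      by_contra hc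
      exact Nat.findGreatest_is_greatest (P := P) (n := w) (k := k) (by omega) hk ⟨Y, x, hY, hc⟩
    let φ' : R →ₗ[K] K := φ ∘ₗ LinearMap.mulLeft K (PowerSeries.coeff e F)
    have key : ∀ (Y : Multiset K) (x : τ) (S : Finset K), Y.card = m → e + 1 ≤ S.card →
        (∀ c ∈ S, φ (PowerSeries.coeff w (dilationProd F (c ::ₘ Y) * G x)) = 0) →
        φ' (PowerSeries.coeff (w - e) (dilationProd F Y * G x)) = 0 := by
      intro Y x S hY hS h
      refine dual_coeff_mul_eq_zero φ F (dilationProd F Y * G x) w S ?_ ?_ e hew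
      · intro c hc
        rw [← mul_assoc, ← dilationProd_cons]
        exact h c hc
      · exact fun k hk hSk => hmax k hk (by omega) Y x hY
    obtain ⟨ψ, w', E, hw, hψ, hstep⟩ := ih φ' (w - e) hPe
    refine ⟨ψ, w', e + E, by omega, hψ, fun r s hrs => ?_⟩
    by_cases hred : e + r ≤ s ∧ 1 ≤ r
    · obtain ⟨hred, hr⟩ := hred
      obtain ⟨r, rfl⟩ := Nat.exists_eq_succ_of_ne_zero (by omega : r ≠ 0)
      have hV : Vanishes F G V φ' (w - e) m r s := by
        intro Y x T U hY hUT hT hU hTV hUY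
        refine key Y x (T \ U) hY (by rw [Finset.card_sdiff_of_subset hUT]; omega) ?_
        intro c hc
        rw [Finset.mem_sdiff] at hc
        refine hrs (c ::ₘ Y) x T (insert c U) (by simp [hY]) ?_ hT ?_ hTV ?_
        · exact Finset.insert_subset hc.1 hUT
        · rw [Finset.card_insert_of_notMem hc.2, hU]
        · intro u hu
          rcases Finset.mem_insert.1 hu with rfl | hu
          · exact Multiset.mem_cons_self _ _
          · exact Multiset.mem_cons_of_mem (hUY u hu)
      refine (hstep r s hV).imp_right fun ⟨h1, h2⟩ => ⟨by omega, le_trans ?_ (le_trans h2 ?_)⟩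
      · exact Nat.mul_le_mul (by omega) (by omega)
      · omega
    · have hV : Vanishes F G V φ' (w - e) m r s := by
        intro Y x T U hY hUT hT hU hTV hUY
        obtain ⟨S, hS⟩ := Infinite.exists_subset_card_eq K (e + 1)
        refine key Y x S hY hS.ge fun c _ => ?_
        exact hrs (c ::ₘ Y) x T U (by simp [hY]) hUT hT hU hTV
          fun u hu => Multiset.mem_cons_of_mem (hUY u hu)
      refine (hstep r s hV).imp_right fun ⟨h1, h2⟩ => ⟨h1, ?_⟩
      calc (m + 1 + 1 - r) * (s + 1 - r) ≤ (m + 1 - r + 1) * (s + 1 - r) :=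
            Nat.mul_le_mul_right _ (by omega)
        _ = (m + 1 - r) * (s + 1 - r) + (s + 1 - r) := by ring
        _ ≤ e + E := by omega

lemma quadratic_bound_step {N D D' w E : ℕ} (hN : 0 < N) (hD : D' ≤ D)
    (hw : (N + 1) * D' ^ 2 ≤ 2 * N * w) (hE : D * (D - D') ≤ E) :
    (N + 2) * D ^ 2 ≤ 2 * (N + 1) * (w + E) := by
  obtain ⟨k, rfl⟩ := Nat.exists_eq_add_of_le hD
  rw [Nat.add_sub_cancel_left] at hE
  refine Nat.le_of_mul_le_mul_left ?_ hN
  zify at *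
  nlinarith [sq_nonneg ((N + 1 : ℤ) * D' - N * (D' + k)),
    mul_le_mul_of_nonneg_left hw (by positivity : (0 : ℤ) ≤ N + 1),
    mul_le_mul_of_nonneg_left hE (by positivity : (0 : ℤ) ≤ 2 * N * (N + 1))]

lemma card_mul_sq_le_of_vanishing [Infinite K] {ι : Type*} (F : ι → PowerSeries R) (d : ℕ)
    (S : Finset ι) (hS : S.Nonempty) (φ : R →ₗ[K] K) (w r : ℕ)
    (hne : ∃ Y : ι → Multiset K, (∀ i ∈ S, (Y i).card = d) ∧
      φ (PowerSeries.coeff w (∏ i ∈ S, dilationProd (F i) (Y i))) ≠ 0)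
    (hv : ∀ (Y : ι → Multiset K) (T : Finset K), (∀ i ∈ S, (Y i).card = d) → T.card = r →
      (∀ t ∈ T, ∀ i ∈ S, t ∈ Y i) →
      φ (PowerSeries.coeff w (∏ i ∈ S, dilationProd (F i) (Y i))) = 0) :
    S.card * (d + 1 - r) ^ 2 ≤ 2 * (S.card - 1) * w := by
  classical
  have peel : ∀ (a : ι) (S : Finset ι), a ∉ S → ∀ (φ : R →ₗ[K] K) (w r : ℕ),
      (∃ Y : ι → Multiset K, (∀ i ∈ insert a S, (Y i).card = d) ∧
        φ (PowerSeries.coeff w (∏ i ∈ insert a S, dilationProd (F i) (Y i))) ≠ 0) →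
      (∀ (Y : ι → Multiset K) (T : Finset K), (∀ i ∈ insert a S, (Y i).card = d) → T.card = r →
        (∀ t ∈ T, ∀ i ∈ insert a S, t ∈ Y i) →
        φ (PowerSeries.coeff w (∏ i ∈ insert a S, dilationProd (F i) (Y i))) = 0) →
      ∃ (ψ : R →ₗ[K] K) (w' E : ℕ), w = w' + E ∧
        (∃ Y : ι → Multiset K, (∀ i ∈ S, (Y i).card = d) ∧
          ψ (PowerSeries.coeff w' (∏ i ∈ S, dilationProd (F i) (Y i))) ≠ 0) ∧
        ∀ s, (∀ (Y : ι → Multiset K) (T : Finset K), (∀ i ∈ S, (Y i).card = d) → T.card = s →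
          (∀ t ∈ T, ∀ i ∈ S, t ∈ Y i) →
          ψ (PowerSeries.coeff w' (∏ i ∈ S, dilationProd (F i) (Y i))) = 0) ∨
          (d + 1 - r) * (s + 1 - r) ≤ E := by
    rintro a S ha φ w r ⟨Y, hY, hYne⟩ hv
    obtain ⟨ψ, w', E, hw, ⟨x, hx⟩, hstep⟩ := exists_leading_dual (F a)
      (fun x : {Y : ι → Multiset K // ∀ i ∈ S, (Y i).card = d} =>
        ∏ i ∈ S, dilationProd (F i) (x.1 i))
      (fun x => {t | ∀ i ∈ S, t ∈ x.1 i}) d φ w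
      ⟨Y a, ⟨Y, fun i hi => hY i (Finset.mem_insert_of_mem hi)⟩,
        hY a (Finset.mem_insert_self _ _), by rwa [Finset.prod_insert ha] at hYne⟩
    refine ⟨ψ, w', E, hw, ⟨x.1, x.2, hx⟩, fun s => ?_⟩
    refine (hstep r s ?_).imp (fun h Y T hY hT hTY => ?_) And.right
    · intro Z x T U hZ hUT hT hU hTV hUY
      have hne : ∀ i ∈ S, i ≠ a := fun i hi h => ha (h ▸ hi)
      have := hv (Function.update x.1 a Z) U ?_ hU ?_
      · rw [Finset.prod_insert ha, Function.update_self] at this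
        rw [← this]
        congr 3
        exact Finset.prod_congr rfl fun i hi => by rw [Function.update_of_ne (hne i hi)]
      · intro i hi
        rcases Finset.mem_insert.1 hi with rfl | hi
        · simpa using hZ
        · rw [Function.update_of_ne (hne i hi)]
          exact x.2 i hi
      · intro u hu i hi
        rcases Finset.mem_insert.1 hi with rfl | hi
        · simpa using hUY u hu
        · rw [Function.update_of_ne (hne i hi)]
          exact hTV u (hUT hu) i hi
    · have := h 0 ⟨Y, hY⟩ T ∅ rfl (Finset.empty_subset _) hT rfl (fun t ht => hTY t ht) (by simp)
      simpa [dilationProd_zero] using this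
  induction hS using Finset.Nonempty.cons_induction generalizing φ w r with
  | singleton a =>
    obtain ⟨ψ, w', E, -, ⟨Y, -, hY⟩, hstep⟩ := peel a ∅ (by simp) φ w r hne hv
    obtain ⟨T, hT⟩ := Infinite.exists_subset_card_eq K (E + r)
    rcases hstep (E + r) with h | h
    · exact absurd (h Y T (by simp) hT (by simp)) hY
    · have : d + 1 - r = 0 := by
        by_contra hpos
        have : 1 * (E + r + 1 - r) ≤ (d + 1 - r) * (E + r + 1 - r) :=
          Nat.mul_le_mul_right _ (by omega)
        omega
      simp [this]
  | cons a S ha hS ih =>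
    rw [Finset.cons_eq_insert] at hne hv ⊢
    rw [Finset.card_insert_of_notMem ha, Nat.add_sub_cancel]
    rcases lt_or_ge d r with hr | hr
    · simp [show d + 1 - r = 0 by omega]
    obtain ⟨ψ, w', E, rfl, hne', hstep⟩ := peel a S ha φ w r hne hv
    let P : ℕ → Prop := fun s => ∀ (Y : ι → Multiset K) (T : Finset K),
      (∀ i ∈ S, (Y i).card = d) → T.card = s → (∀ t ∈ T, ∀ i ∈ S, t ∈ Y i) →
      ψ (PowerSeries.coeff w' (∏ i ∈ S, dilationProd (F i) (Y i))) = 0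
    have hex : ∃ s, r ≤ s ∧ (P s ∨ d + 1 ≤ s) := ⟨d + 1, by omega, Or.inr le_rfl⟩
    obtain ⟨hrs, hs⟩ := Nat.find_spec hex
    have hsd : Nat.find hex ≤ d + 1 := Nat.find_min' hex ⟨by omega, Or.inr le_rfl⟩
    have hmin := fun k => Nat.find_min hex (m := k)
    set s := Nat.find hex
    have hE : (d + 1 - r) * (s - r) ≤ E := by
      rcases hrs.eq_or_lt with h | h
      · simp [← h]
      · have hnot := hmin (s - 1) (by omega)
        have := (hstep (s - 1)).resolve_left fun h' => hnot ⟨by omega, Or.inl h'⟩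
        rwa [show s - 1 + 1 - r = s - r by omega] at this
    have hcard : 0 < S.card := hS.card_pos
    obtain ⟨N, hN⟩ := Nat.exists_eq_add_of_lt hcard
    have hw : S.card * (d + 1 - s) ^ 2 ≤ 2 * (S.card - 1) * w' := by
      rcases hs with hs | hs
      · exact ih ψ w' s hne' hs
      · simp [show d + 1 - s = 0 by omega]
    rcases Nat.eq_zero_or_pos N with rfl | hNpos
    · have hS1 : S.card = 1 := by omega
      rw [hS1] at hw ⊢
      have hds : d + 1 - s = 0 := by simpa using hw
      rw [show s - r = d + 1 - r by omega] at hE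
      nlinarith
    · have hSN : S.card = N + 1 := by omega
      rw [hSN] at hw ⊢
      refine quadratic_bound_step hNpos (D' := d + 1 - s) (by omega) (by simpa using hw) ?_
      rwa [show d + 1 - r - (d + 1 - s) = s - r by omega]

lemma dual_prod_coeff_mul_eq_zero [Infinite K] {κ : Type*} (F : κ → PowerSeries R) (h : κ → ℕ)
    (S : Finset κ) (φ : R →ₗ[K] K) (w : ℕ) (hw : w = ∑ j ∈ S, h j)
    (hz : ∀ x : κ → K, φ (PowerSeries.coeff w
      (∏ j ∈ S, PowerSeries.rescale (algebraMap K R (x j)) (F j))) = 0) :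
    φ (∏ j ∈ S, PowerSeries.coeff (h j) (F j)) = 0 := by
  classical
  induction S using Finset.induction generalizing φ w with
  | empty =>
    subst hw
    simpa using hz 0
  | insert a S ha ih =>
    rw [Finset.sum_insert ha] at hw
    rw [Finset.prod_insert ha]
    refine ih (φ ∘ₗ LinearMap.mulLeft K (PowerSeries.coeff (h a) (F a))) (w - h a) (by omega) ?_
    intro x
    refine dual_coeff_mul_eq_zero_of_forall φ (F a) _ w (fun c => ?_) (h a) (by omega)
    have := hz (Function.update x a c)
    rw [Finset.prod_insert ha, Function.update_self] at this
    rw [← this]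
    congr 3
    refine Finset.prod_congr rfl fun i hi => ?_
    have hia : i ≠ a := fun hia => ha (hia ▸ hi)
    rw [Function.update_of_ne hia]

/-- If a product of `n` power series over a `K`-algebra vanishes, then so does the `d`-th power of
the product of their coefficients of indices `h i`, provided `2 (n - 1) ∑ h i < n d`. -/
theorem prod_coeff_pow_eq_zero (K : Type*) {R ι : Type*} [Field K] [Infinite K] [CommRing R]
    [Algebra K R] [Fintype ι] (F : ι → PowerSeries R) (hF : ∏ i, F i = 0) (h : ι → ℕ) (d : ℕ)
    (hd : 2 * (Fintype.card ι - 1) * ∑ i, h i < Fintype.card ι * d) :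
    (∏ i, PowerSeries.coeff (h i) (F i)) ^ d = 0 := by
  classical
  rw [← Module.forall_dual_apply_eq_zero_iff K]
  intro φ
  by_contra hφ
  have hpos : 0 < Fintype.card ι * d := by omega
  have hS : (Finset.univ : Finset ι).Nonempty := by
    rw [← Finset.card_pos, Finset.card_univ]
    exact Nat.pos_of_mul_pos_right hpos
  have hd0 : 0 < d := Nat.pos_of_mul_pos_left hpos
  have hbound := card_mul_sq_le_of_vanishing F d Finset.univ hS φ (d * ∑ i, h i) 1 ?_ ?_
  · rw [Finset.card_univ, Nat.add_sub_cancel] at hbound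
    have := Nat.mul_lt_mul_of_pos_left hd hd0
    nlinarith
  · by_contra! hcon
    apply hφ
    have := dual_prod_coeff_mul_eq_zero (fun j : ι × Fin d => F j.1) (fun j => h j.1)
      Finset.univ φ (d * ∑ i, h i) (by simp [Fintype.sum_prod_type, Finset.mul_sum]) ?_
    · simpa [Fintype.prod_prod_type, Finset.prod_pow] using this
    · intro x
      have := hcon (fun i => Finset.univ.val.map fun j => x (i, j)) (by simp)
      rw [Fintype.prod_prod_type]
      simp only [dilationProd, Multiset.map_map] at this
      exact this
  · intro Y T hY hT hTY
    obtain ⟨t, rfl⟩ := Finset.card_eq_one.1 hT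
    have hdvd : ∏ i, PowerSeries.rescale (algebraMap K R t) (F i) ∣
        ∏ i, dilationProd (F i) (Y i) :=
      Finset.prod_dvd_prod_of_dvd _ _ fun i hi => Multiset.dvd_prod
        (Multiset.mem_map_of_mem _ (hTY t (by simp) i hi))
    rw [← map_prod, hF, map_zero, zero_dvd_iff] at hdvd
    rw [hdvd, map_zero, map_zero]

end

end SeriesProduct

namespace Derivation

variable {K A : Type*} [Field K] [CommRing A] [Algebra K A]

/-- The Taylor series `∑ D^k(a) t^k / k!` of an element along a derivation. -/
noncomputable def taylorSeries (D : Derivation K A A) (a : A) : PowerSeries A :=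
  PowerSeries.mk fun k => (k.factorial : K)⁻¹ • (⇑D)^[k] a

lemma derivative_taylorSeries [CharZero K] (D : Derivation K A A) (a : A) (k : ℕ) :
    D (PowerSeries.coeff k (taylorSeries D a)) =
      (k + 1 : K) • PowerSeries.coeff (k + 1) (taylorSeries D a) := by
  have h1 : (k + 1 : K) ≠ 0 := by exact_mod_cast k.succ_ne_zero
  simp only [taylorSeries, PowerSeries.coeff_mk, map_smul, smul_smul,
    Function.iterate_succ_apply']
  congr 1
  rw [Nat.factorial_succ]
  push_cast
  rw [mul_inv, mul_inv_cancel_left₀ h1]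

lemma taylorSeries_mul [CharZero K] (D : Derivation K A A) (a b : A) :
    taylorSeries D (a * b) = taylorSeries D a * taylorSeries D b := by
  ext k
  induction k with
  | zero => simp [taylorSeries, PowerSeries.coeff_mul]
  | succ k ih =>
    have h1 : (k + 1 : K) ≠ 0 := by exact_mod_cast k.succ_ne_zero
    refine smul_right_injective A h1 ?_
    simp only
    rw [← derivative_taylorSeries, ih, PowerSeries.coeff_mul, PowerSeries.coeff_mul, map_sum,
      Finset.smul_sum]
    simp only [Derivation.leibniz, derivative_taylorSeries, smul_eq_mul]
    rw [Finset.sum_add_distrib]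
    have hsplit : ∀ p ∈ Finset.HasAntidiagonal.antidiagonal (k + 1),
        (k + 1 : K) • (PowerSeries.coeff p.1 (taylorSeries D a) *
          PowerSeries.coeff p.2 (taylorSeries D b)) =
        (p.2 : K) • (PowerSeries.coeff p.1 (taylorSeries D a) *
          PowerSeries.coeff p.2 (taylorSeries D b)) +
        (p.1 : K) • (PowerSeries.coeff p.1 (taylorSeries D a) *
          PowerSeries.coeff p.2 (taylorSeries D b)) := by
      intro p hp
      rw [← add_smul, add_comm (p.2 : K)]
      congr 1
      exact_mod_cast (Finset.HasAntidiagonal.mem_antidiagonal.1 hp).symm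
    rw [Finset.sum_congr rfl hsplit, Finset.sum_add_distrib,
      Finset.Nat.sum_antidiagonal_succ', Finset.Nat.sum_antidiagonal_succ]
    simp only [Nat.cast_zero, zero_smul, zero_add, Nat.cast_add, Nat.cast_one]
    congr 1
    · exact Finset.sum_congr rfl fun p _ => by rw [mul_smul_comm]
    · exact Finset.sum_congr rfl fun p _ => by rw [mul_smul_comm, mul_comm]

lemma taylorSeries_one [CharZero K] (D : Derivation K A A) : taylorSeries D 1 = 1 := by
  ext k
  cases k with
  | zero => simp [taylorSeries]
  | succ k =>
    simp [taylorSeries, Function.iterate_succ_apply, PowerSeries.coeff_one,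
      iterate_map_zero]

lemma taylorSeries_prod [CharZero K] {ι : Type*} (D : Derivation K A A) (S : Finset ι)
    (a : ι → A) : taylorSeries D (∏ i ∈ S, a i) = ∏ i ∈ S, taylorSeries D (a i) := by
  classical
  induction S using Finset.induction with
  | empty => simp [taylorSeries_one]
  | insert i S hi ih => rw [Finset.prod_insert hi, Finset.prod_insert hi, taylorSeries_mul, ih]

end Derivation

lemma SeriesProduct.exponent_bound {n : ℕ} (h : Fin n → ℕ) (hn : n ≠ 1) :
    2 * (Fintype.card (Option {i // h i ≠ 0}) - 1) * ∑ i, h i <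
      Fintype.card (Option {i // h i ≠ 0}) *
        ((Finset.univ.sup fun i => (h i + 1) * (∑ j, h j - h i)) + 1) := by
  classical
  set H := ∑ j, h j with hH
  set B := Finset.univ.sup fun i => (h i + 1) * (H - h i)
  have hB : ∀ i, (h i + 1) * (H - h i) ≤ B := fun i =>
    Finset.le_sup (f := fun i => (h i + 1) * (H - h i)) (Finset.mem_univ i)
  rw [Fintype.card_option, Nat.add_sub_cancel]
  have hcard : Fintype.card {i // h i ≠ 0} = (Finset.univ.filter fun i => h i ≠ 0).card :=
    Fintype.card_subtype _
  have hsum : H = ∑ i ∈ Finset.univ.filter fun i => h i ≠ 0, h i := by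
    rw [hH, Finset.sum_filter_ne_zero]
  rw [hcard]
  set S := Finset.univ.filter fun i => h i ≠ 0 with hSdef
  have hmem : ∀ i, i ∈ S ↔ h i ≠ 0 := fun i => by simp [hSdef]
  have hSH : S.card ≤ H := by
    rw [hsum, Finset.card_eq_sum_ones]
    exact Finset.sum_le_sum fun i hi => Nat.one_le_iff_ne_zero.2 ((hmem i).1 hi)
  rcases Nat.lt_or_ge S.card 2 with hk | hk
  · interval_cases hc : S.card
    · simp
    · obtain ⟨i, hi⟩ := Finset.card_eq_one.1 hc
      obtain ⟨j, hj⟩ : ∃ j, h j = 0 := by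
        by_contra! hcon
        have : S = Finset.univ := Finset.eq_univ_of_forall fun j => (hmem j).2 (hcon j)
        rw [this, Finset.card_univ, Fintype.card_fin] at hc
        exact hn hc
      have := hB j
      rw [hj] at this
      omega
  · suffices hd : 2 * H ≤ B + 2 by nlinarith
    obtain ⟨i, hi, j, hj, hij⟩ := Finset.one_lt_card.1 hk
    by_cases hone : ∃ l, h l = 1
    · obtain ⟨l, hl⟩ := hone
      have := hB l
      rw [hl] at this
      omega
    · push Not at hone
      have hi2 : 2 ≤ h i := by have := hone i; have := (hmem i).1 hi; omega
      have hj2 : 2 ≤ h j := by have := hone j; have := (hmem j).1 hj; omega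
      have hijH : h i + h j ≤ H := by
        rw [hH, ← Finset.sum_pair hij]
        exact Finset.sum_le_sum_of_subset (Finset.subset_univ _)
      have hBi := hB i
      obtain ⟨b, hb⟩ := Nat.exists_eq_add_of_le (by omega : h i + 2 ≤ H)
      obtain ⟨a, ha⟩ := Nat.exists_eq_add_of_le hi2
      rw [show H - h i = b + 2 by omega, ha] at hBi
      rw [hb, ha]
      nlinarith [Nat.zero_le (a * b)]

/-- In `K{y_1,…,y_n} = K[y_i^{(j)}]` (variables indexed by
`Fin n × ℕ`) with the derivation `D` determined by `D(y_i^{(j)}) = y_i^{(j+1)}`: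
for `H = h_1 + ⋯ + h_n` and `d = max_i (h_i+1)(H-h_i) + 1`, the power
`(y_1^{(h_1)} ⋯ y_n^{(h_n)})^d` belongs to the differential ideal `[y_1⋯y_n]`, i.e. to
the ideal generated by all the derivatives `D^k(y_1⋯y_n)`, `k ∈ ℤ_{≥0}`. -/
theorem monomial_pow_mem_differential_ideal
    (K : Type*) [Field K] [CharZero K] (n : ℕ) (hn : 0 < n) (h : Fin n → ℕ)
    (D : Derivation K (MvPolynomial (Fin n × ℕ) K) (MvPolynomial (Fin n × ℕ) K))
    (hD : D = MvPolynomial.mkDerivation K (fun p : Fin n × ℕ => X (p.1, p.2 + 1)))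
    (d : ℕ) (hd : d = (Finset.univ.sup fun i => (h i + 1) * (∑ j, h j - h i)) + 1) :
    (∏ i, (X (i, h i) : MvPolynomial (Fin n × ℕ) K)) ^ d ∈
      Ideal.span {q : MvPolynomial (Fin n × ℕ) K |
        ∃ k : ℕ, q = (⇑D)^[k] (∏ i, X (i, 0))} := by
  classical
  have hiter : ∀ (i : Fin n) (k : ℕ),
      (⇑D)^[k] (X (i, 0) : MvPolynomial (Fin n × ℕ) K) = X (i, k) := by
    intro i k
    induction k with
    | zero => rfl
    | succ k ih => rw [Function.iterate_succ_apply', ih, hD, MvPolynomial.mkDerivation_X]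
  by_cases hn1 : n = 1
  · subst hn1
    refine Ideal.pow_mem_of_mem _ ?_ d (by omega)
    refine Ideal.subset_span ⟨h 0, ?_⟩
    simp [hiter]
  set I := Ideal.span {q : MvPolynomial (Fin n × ℕ) K |
        ∃ k : ℕ, q = (⇑D)^[k] (∏ i, X (i, 0))}
  let π := Ideal.Quotient.mkₐ K I
  let F : Fin n → PowerSeries (MvPolynomial (Fin n × ℕ) K ⧸ I) := fun i =>
    PowerSeries.map (π : MvPolynomial (Fin n × ℕ) K →+* _) (D.taylorSeries (X (i, 0)))
  have hF : ∏ i, F i = 0 := by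
    rw [← map_prod, ← Derivation.taylorSeries_prod]
    ext k
    rw [PowerSeries.coeff_map, Derivation.taylorSeries, PowerSeries.coeff_mk, map_zero]
    refine Ideal.Quotient.eq_zero_iff_mem.2 ?_
    exact Submodule.smul_of_tower_mem I _ (Ideal.subset_span ⟨k, rfl⟩)
  have hcoeff : ∀ i k, PowerSeries.coeff k (F i) = (k.factorial : K)⁻¹ • π (X (i, k)) := by
    intro i k
    rw [PowerSeries.coeff_map, Derivation.taylorSeries, PowerSeries.coeff_mk, hiter]
    exact map_smul π _ _
  let G : Option {i // h i ≠ 0} → PowerSeries (MvPolynomial (Fin n × ℕ) K ⧸ I) := fun o =>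
    o.elim (∏ i : {i // ¬ h i ≠ 0}, F i) fun i => F i
  have hprod := SeriesProduct.prod_coeff_pow_eq_zero K G ?_ (fun o => o.elim 0 fun i => h i) d ?_
  · have hprod' : (∏ i, PowerSeries.coeff (h i) (F i)) ^ d = 0 := by
      rw [← hprod, Fintype.prod_option, ← Fintype.prod_subtype_mul_prod_subtype (fun i => h i ≠ 0),
        mul_comm]
      congr 2
      simp only [G, Option.elim, PowerSeries.coeff_zero_eq_constantCoeff_apply, map_prod]
      refine Finset.prod_congr rfl fun i _ => ?_
      rw [not_not.1 i.2, PowerSeries.coeff_zero_eq_constantCoeff_apply]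
    simp only [hcoeff, Finset.prod_smul, smul_pow] at hprod'
    rw [smul_eq_zero_iff_right, ← map_prod, ← map_pow] at hprod'
    · exact Ideal.Quotient.eq_zero_iff_mem.1 hprod'
    · refine pow_ne_zero _ (Finset.prod_ne_zero_iff.2 fun i _ => inv_ne_zero ?_)
      exact_mod_cast (h i).factorial_ne_zero
  · rw [Fintype.prod_option, mul_comm]
    simp only [G, Option.elim]
    rw [Fintype.prod_subtype_mul_prod_subtype (fun i => h i ≠ 0) F, hF]
  · have hsum : ∑ o : Option {i // h i ≠ 0}, (o.elim 0 fun i => h i) = ∑ i, h i := by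
      rw [Fintype.sum_option, ← Fintype.sum_subtype_add_sum_subtype (fun i => h i ≠ 0) h]
      have : ∑ i : {i // ¬ h i ≠ 0}, h i = 0 :=
        Finset.sum_eq_zero fun i _ => not_not.1 i.2
      simp only [Option.elim, this, zero_add, add_zero]
    rw [hsum, hd]
    exact SeriesProduct.exponent_bound h hn1
end

section
/- For every field k of characteristic zero and every λ = (λ_1,…,λ_n) ∈ ℤ_{≥0}^n with λ_1+⋯+λ_n = ℓ, the k-algebra C_λ(k) is a finite-dimensional k-vector space of dimension ℓ!/(λ_1!·λ_2!⋯λ_n!). -/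
open MvPolynomial

universe u

/-- `S`, with the elements `x i j`, is the universal `R`-algebra in which each monic polynomial
`f i` with `i ∈ s` is the product of the linear factors `X - x i j`. -/
structure IsUniversalSplitting {R S : Type u} [CommRing R] [CommRing S] [Algebra R S]
    {ι : Type} {d : ι → ℕ} (s : Finset ι) (f : ι → Polynomial R) (x : ∀ i, Fin (d i) → S) :
    Prop where
  map_eq_prod : ∀ i ∈ s, (f i).map (algebraMap R S) = ∏ j, (Polynomial.X - Polynomial.C (x i j))
  exists_lift : ∀ {B : Type u} [CommRing B] (g : R →+* B) (b : ∀ i, Fin (d i) → B),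
    (∀ i ∈ s, (f i).map g = ∏ j, (Polynomial.X - Polynomial.C (b i j))) →
      ∃ φ : S →+* B, φ.comp (algebraMap R S) = g ∧ ∀ i ∈ s, ∀ j, φ (x i j) = b i j
  hom_ext : ∀ {B : Type u} [CommRing B] (φ ψ : S →+* B),
    φ.comp (algebraMap R S) = ψ.comp (algebraMap R S) →
      (∀ i ∈ s, ∀ j, φ (x i j) = ψ (x i j)) → φ = ψ

theorem nonempty_basis_fin_mul {R S T : Type u} [CommRing R] [CommRing S] [CommRing T]
    [Algebra R S] [Algebra S T] [Algebra R T] [IsScalarTower R S T] {m n : ℕ}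
    (hS : Nonempty (Module.Basis (Fin m) R S)) (hT : Nonempty (Module.Basis (Fin n) S T)) :
    Nonempty (Module.Basis (Fin (m * n)) R T) := by
  obtain ⟨b⟩ := hS
  obtain ⟨c⟩ := hT
  exact ⟨(b.smulTower c).reindex finProdFinEquiv⟩

/-- A monic polynomial of degree `d` has a universal splitting algebra, free of rank `d!`. -/
theorem exists_universal_splitting_single (d : ℕ) :
    ∀ (R : Type u) [CommRing R] [Nontrivial R] (f : Polynomial R), f.Monic → f.natDegree = d →
      ∃ (S : Type u) (_ : CommRing S) (_ : Algebra R S) (x : Fin d → S),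
        Nonempty (Module.Basis (Fin d.factorial) R S) ∧
        f.map (algebraMap R S) = ∏ j, (Polynomial.X - Polynomial.C (x j)) ∧
        (∀ (B : Type u) [CommRing B] (g : R →+* B) (b : Fin d → B),
          f.map g = ∏ j, (Polynomial.X - Polynomial.C (b j)) →
            ∃ φ : S →+* B, φ.comp (algebraMap R S) = g ∧ ∀ j, φ (x j) = b j) ∧
        (∀ (B : Type u) [CommRing B] (φ ψ : S →+* B),
          φ.comp (algebraMap R S) = ψ.comp (algebraMap R S) →
            (∀ j, φ (x j) = ψ (x j)) → φ = ψ) := by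
  induction d with
  | zero =>
    intro R _ _ f hf hd
    have hf1 : f = 1 := hf.natDegree_eq_zero.mp hd
    refine ⟨R, inferInstance, inferInstance, Fin.elim0, ⟨?_⟩, by simp [hf1], ?_, ?_⟩
    · exact (Module.Basis.singleton (Fin 1) R)
    · intro B _ g b _
      exact ⟨g, by ext; simp, fun j => j.elim0⟩
    · intro B _ φ ψ h _
      simpa using h
  | succ d ih =>
    intro R _ _ f hf hd
    have : Nontrivial (AdjoinRoot f) := by
      have : Nonempty (Fin (AdjoinRoot.powerBasis' hf).dim) := by
        rw [AdjoinRoot.powerBasis'_dim, hd]; infer_instance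
      exact (AdjoinRoot.powerBasis' hf).basis.repr.toEquiv.nontrivial
    set r := AdjoinRoot.root f
    set f' := f.map (AdjoinRoot.of f) with hf'
    set q := f' /ₘ (Polynomial.X - Polynomial.C r) with hq
    have hmul : (Polynomial.X - Polynomial.C r) * q = f' :=
      Polynomial.mul_divByMonic_eq_iff_isRoot.mpr (AdjoinRoot.isRoot_root f)
    have hqm : q.Monic := (Polynomial.monic_X_sub_C r).of_mul_monic_left (hmul ▸ hf.map _)
    have hqd : q.natDegree = d := by
      rw [hq, Polynomial.natDegree_divByMonic _ (Polynomial.monic_X_sub_C r), hf',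
        hf.natDegree_map, hd, Polynomial.natDegree_X_sub_C, Nat.add_sub_cancel]
    obtain ⟨S, _, _, x, hbasis, hprod, hlift, hext⟩ := ih (AdjoinRoot f) q hqm hqd
    let _ : Algebra R S := ((algebraMap (AdjoinRoot f) S).comp (AdjoinRoot.of f)).toAlgebra
    have hR : algebraMap R S = (algebraMap (AdjoinRoot f) S).comp (AdjoinRoot.of f) := rfl
    have : IsScalarTower R (AdjoinRoot f) S := IsScalarTower.of_algebraMap_eq' hR
    refine ⟨S, inferInstance, inferInstance, Fin.cons (algebraMap _ S r) x, ?_, ?_, ?_, ?_⟩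
    · refine nonempty_basis_fin_mul ⟨?_⟩ hbasis
      exact (AdjoinRoot.powerBasis' hf).basis.reindex
        (finCongr (by rw [AdjoinRoot.powerBasis'_dim, hd]))
    · rw [hR, ← Polynomial.map_map, ← hf', ← hmul, Polynomial.map_mul, hprod, Fin.prod_univ_succ]
      simp
    · intro B _ g b hb
      rw [Fin.prod_univ_succ] at hb
      have hroot : f.eval₂ g (b 0) = 0 := by
        rw [← Polynomial.eval_map, hb]; simp
      have hcomp : (AdjoinRoot.lift g (b 0) hroot).comp (AdjoinRoot.of f) = g :=
        AdjoinRoot.lift_comp_of hroot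
      have hr : AdjoinRoot.lift g (b 0) hroot r = b 0 := AdjoinRoot.lift_root hroot
      obtain ⟨φ, hφ, hφx⟩ := hlift B (AdjoinRoot.lift g (b 0) hroot) (fun j => b j.succ) (by
        apply (Polynomial.monic_X_sub_C (b 0)).isRegular.left
        have h := congrArg (Polynomial.map (AdjoinRoot.lift g (b 0) hroot)) hmul
        rw [Polynomial.map_mul, hf', Polynomial.map_map, hcomp, hb] at h
        simpa [hr] using h)
      refine ⟨φ, by rw [hR, ← RingHom.comp_assoc, hφ, hcomp], Fin.cases ?_ hφx⟩
      rw [Fin.cons_zero, ← RingHom.comp_apply, hφ, hr]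
    · intro B _ φ ψ h hx
      refine hext B φ ψ ?_ fun j => by simpa using hx j.succ
      refine AdjoinRoot.ringHom_ext ?_ ?_
      · simpa only [hR, RingHom.comp_assoc] using h
      · simpa using hx 0

/-- A finite family of monic polynomials of degrees `d i` has a universal splitting algebra, free
of rank `∏ i, (d i)!`. -/
theorem exists_isUniversalSplitting {R : Type u} [CommRing R] [Nontrivial R] {ι : Type}
    [DecidableEq ι] {d : ι → ℕ} (f : ι → Polynomial R) (hf : ∀ i, (f i).Monic)
    (hd : ∀ i, (f i).natDegree = d i) (s : Finset ι) :
    ∃ (S : Type u) (_ : CommRing S) (_ : Algebra R S) (x : ∀ i, Fin (d i) → S),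
      Nonempty (Module.Basis (Fin (∏ i ∈ s, (d i).factorial)) R S) ∧
        IsUniversalSplitting s f x := by
  induction s using Finset.induction_on with
  | empty =>
    refine ⟨R, inferInstance, inferInstance, fun _ _ => 0, ⟨?_⟩, ⟨by simp, ?_, ?_⟩⟩
    · exact (Module.Basis.singleton (Fin 1) R)
    · intro B _ g b _
      exact ⟨g, by ext; simp, by simp⟩
    · intro B _ φ ψ h _
      simpa using h
  | insert a s ha ih =>
    obtain ⟨S, _, _, x, hbasis, hS⟩ := ih
    have : Nontrivial S := by
      obtain ⟨b⟩ := hbasis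
      have : Nonempty (Fin (∏ i ∈ s, (d i).factorial)) :=
        ⟨⟨0, Finset.prod_pos fun i _ => Nat.factorial_pos _⟩⟩
      exact b.repr.toEquiv.nontrivial
    obtain ⟨T, _, _, z, hbasis', hprod, hlift, hext⟩ := exists_universal_splitting_single (d a) S
      ((f a).map (algebraMap R S)) ((hf a).map _) (by rw [(hf a).natDegree_map, hd])
    let _ : Algebra R T := ((algebraMap S T).comp (algebraMap R S)).toAlgebra
    have hR : algebraMap R T = (algebraMap S T).comp (algebraMap R S) := rfl
    have : IsScalarTower R S T := IsScalarTower.of_algebraMap_eq' hR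
    have hne : ∀ i ∈ s, i ≠ a := fun i hi h => ha (h ▸ hi)
    refine ⟨T, inferInstance, inferInstance,
      Function.update (fun i j => algebraMap S T (x i j)) a z, ?_, ⟨?_, ?_, ?_⟩⟩
    · rw [Finset.prod_insert ha, mul_comm]
      exact nonempty_basis_fin_mul hbasis hbasis'
    · rw [Finset.forall_mem_insert, hR]
      refine ⟨by simpa [Polynomial.map_map] using hprod, fun i hi => ?_⟩
      rw [← Polynomial.map_map, hS.map_eq_prod i hi, Function.update_of_ne (hne i hi)]
      simp [Polynomial.map_prod]
    · intro B _ g b hb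
      rw [Finset.forall_mem_insert] at hb
      obtain ⟨φ, hφ, hφx⟩ := hS.exists_lift g b hb.2
      obtain ⟨ψ, hψ, hψz⟩ := hlift B φ (b a) (by rw [Polynomial.map_map, hφ, hb.1])
      refine ⟨ψ, by rw [hR, ← RingHom.comp_assoc, hψ, hφ], ?_⟩
      rw [Finset.forall_mem_insert]
      refine ⟨by simpa using hψz, fun i hi j => ?_⟩
      rw [Function.update_of_ne (hne i hi), ← RingHom.comp_apply, hψ, hφx i hi]
    · intro B _ φ ψ h hx
      rw [Finset.forall_mem_insert] at hx
      refine hext B φ ψ (hS.hom_ext _ _ ?_ fun i hi j => ?_) (by simpa using hx.1)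
      · simpa only [hR, RingHom.comp_assoc] using h
      · simpa [Function.update_of_ne (hne i hi)] using hx.2 i hi j

/-- The monic polynomial of degree `d` with lower coefficients `a`. -/
noncomputable def monicOfCoeffs {A : Type*} [CommRing A] {d : ℕ} (a : Fin d → A) : Polynomial A :=
  (∑ j : Fin d, Polynomial.C (a j) * Polynomial.X ^ (j : ℕ)) + Polynomial.X ^ d

section monicOfCoeffs

variable {A B : Type*} [CommRing A] [CommRing B] {d : ℕ}

theorem monic_monicOfCoeffs (a : Fin d → A) : (monicOfCoeffs a).Monic := by
  rw [monicOfCoeffs, add_comm]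
  exact Polynomial.monic_X_pow_add (Polynomial.degree_sum_fin_lt a)

theorem natDegree_monicOfCoeffs [Nontrivial A] (a : Fin d → A) :
    (monicOfCoeffs a).natDegree = d := by
  rw [monicOfCoeffs, add_comm]
  refine Polynomial.natDegree_eq_of_degree_eq_some ?_
  rw [Polynomial.degree_add_eq_left_of_degree_lt, Polynomial.degree_X_pow]
  rw [Polynomial.degree_X_pow]
  exact Polynomial.degree_sum_fin_lt a

theorem map_monicOfCoeffs (g : A →+* B) (a : Fin d → A) :
    (monicOfCoeffs a).map g = monicOfCoeffs fun j => g (a j) := by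
  simp [monicOfCoeffs, Polynomial.map_sum]

theorem coeff_monicOfCoeffs (a : Fin d → A) (j : Fin d) :
    (monicOfCoeffs a).coeff j = a j := by
  simp [monicOfCoeffs, Polynomial.finsetSum_coeff, Polynomial.coeff_X_pow, Fin.val_inj, j.2.ne]

theorem monicOfCoeffs_coeff {p : Polynomial A} (hp : p.Monic) (hd : p.natDegree = d) :
    monicOfCoeffs (fun j : Fin d => p.coeff j) = p := by
  subst hd
  conv_rhs => rw [hp.as_sum]
  rw [monicOfCoeffs, add_comm, Finset.sum_range]

end monicOfCoeffs

/-- If `S` is free of rank `m > 0` over a `k`-algebra `A`, then the dimensions over `k` are related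
by `dim S = m * dim A`. -/
theorem finiteDimensional_and_mul_finrank_eq {k A S : Type*} [Field k] [CommRing A] [CommRing S]
    [Algebra k A] [Algebra A S] [Algebra k S] [FiniteDimensional k S]
    (h : algebraMap k S = (algebraMap A S).comp (algebraMap k A)) {m : ℕ} (hm : 0 < m) (b : Module.Basis (Fin m) A S) :
    FiniteDimensional k A ∧ m * Module.finrank k A = Module.finrank k S := by
  have : IsScalarTower k A S := IsScalarTower.of_algebraMap_eq' h
  let e : S ≃ₗ[k] (Fin m → A) := b.equivFun.restrictScalars k
  have : FiniteDimensional k (Fin m → A) := e.finiteDimensional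
  have : FiniteDimensional k A :=
    Module.Finite.of_surjective (LinearMap.proj (R := k) (φ := fun _ : Fin m => A) ⟨0, hm⟩)
      (LinearMap.proj_surjective _)
  refine ⟨this, ?_⟩
  rw [e.finrank_eq, Module.finrank_pi_fintype]
  simp

/-- Let `k` be a field of characteristic zero and
`λ = (λ_1,…,λ_n)` with `∑ λ_i = ℓ`.  `C_λ(k)` is the quotient of
`k[y_{i,j} : 1 ≤ i ≤ n, 0 ≤ j ≤ λ_i-1]` (variables indexed by `Σ i : Fin n, Fin (λ i)`)
by the ideal generated by the coefficients of `t^0,…,t^{ℓ-1}` in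
`∏_{i=1}^n (y_{i,0} + y_{i,1} t + ⋯ + y_{i,λ_i-1} t^{λ_i-1} + t^{λ_i})`.
Then `C_λ(k)` is a finite-dimensional `k`-vector space of dimension
`ℓ!/(λ_1! ⋯ λ_n!)`. -/
theorem finrank_C_lam
    (k : Type*) [Field k] [CharZero k] {n : ℕ} (lam : Fin n → ℕ)
    (ℓ : ℕ) (hℓ : ℓ = ∑ i, lam i) (hpos : 0 < ℓ)
    (P : Polynomial (MvPolynomial (Σ i : Fin n, Fin (lam i)) k))
    (hP : P = ∏ i : Fin n,
      ((∑ j : Fin (lam i), Polynomial.C (X (⟨i, j⟩ : Σ i : Fin n, Fin (lam i))) *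
          Polynomial.X ^ (j : ℕ)) + Polynomial.X ^ (lam i)))
    (IC : Ideal (MvPolynomial (Σ i : Fin n, Fin (lam i)) k))
    (hIC : IC = Ideal.span {q | ∃ d < ℓ, q = P.coeff d}) :
    FiniteDimensional k (MvPolynomial (Σ i : Fin n, Fin (lam i)) k ⧸ IC) ∧
      Module.finrank k (MvPolynomial (Σ i : Fin n, Fin (lam i)) k ⧸ IC) =
        ℓ.factorial / ∏ i, (lam i).factorial := by
  obtain ⟨T, _, _, z, ⟨bT⟩, hTprod, hTlift, hText⟩ := exists_universal_splitting_single ℓ k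
    (Polynomial.X ^ ℓ) (Polynomial.monic_X_pow ℓ) (Polynomial.natDegree_X_pow ℓ)
  have : Nontrivial T := by
    have : Nonempty (Fin ℓ.factorial) := ⟨⟨0, ℓ.factorial_pos⟩⟩
    exact bT.repr.toEquiv.nontrivial
  have hP' : P = ∏ i : Fin n, monicOfCoeffs fun j : Fin (lam i) => X ⟨i, j⟩ := hP
  have hPmonic : P.Monic := hP' ▸ Polynomial.monic_prod_of_monic _ _ fun i _ =>
    monic_monicOfCoeffs _
  have hPdeg : P.natDegree = ℓ := by
    rw [hP', Polynomial.natDegree_prod_of_monic _ _ fun i _ => monic_monicOfCoeffs _, hℓ]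
    exact Finset.sum_congr rfl fun i _ => natDegree_monicOfCoeffs _
  -- `F` is the tautological factorization of `X ^ ℓ` over the quotient ring
  set mk := Ideal.Quotient.mk IC
  let F : ∀ i : Fin n, Polynomial (MvPolynomial (Σ i : Fin n, Fin (lam i)) k ⧸ IC) :=
    fun i => monicOfCoeffs fun j : Fin (lam i) => mk (X ⟨i, j⟩)
  have hF : ∏ i, F i = Polynomial.X ^ ℓ := by
    have h1 : ∏ i, F i = P.map mk := by
      rw [hP', Polynomial.map_prod]
      exact Finset.prod_congr rfl fun i _ => (map_monicOfCoeffs _ _).symm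
    rw [h1, hPmonic.as_sum, hPdeg, Polynomial.map_add, Polynomial.map_sum,
      Finset.sum_eq_zero, add_zero, Polynomial.map_pow, Polynomial.map_X]
    intro d hd
    have : mk (P.coeff d) = 0 := by
      rw [Ideal.Quotient.eq_zero_iff_mem, hIC]
      exact Ideal.subset_span ⟨d, Finset.mem_range.mp hd, rfl⟩
    simp [this]
  obtain ⟨e⟩ : Nonempty ((Σ i : Fin n, Fin (lam i)) ≃ Fin ℓ) :=
    ⟨finSigmaFinEquiv.trans (finCongr hℓ.symm)⟩
  let G : ∀ i : Fin n, Polynomial T :=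
    fun i => ∏ j : Fin (lam i), (Polynomial.X - Polynomial.C (z (e ⟨i, j⟩)))
  have hGcoeff : ∀ i, monicOfCoeffs (fun j : Fin (lam i) => (G i).coeff j) = G i := fun i =>
    monicOfCoeffs_coeff (Polynomial.monic_prod_X_sub_C _ _)
      (by rw [Polynomial.natDegree_finsetProd_X_sub_C_eq_card]; simp)
  have hGprod : ∏ i, G i = Polynomial.X ^ ℓ := by
    rw [← Fintype.prod_sigma' (fun i j => Polynomial.X - Polynomial.C (z (e ⟨i, j⟩)))]
    rw [e.prod_comp (fun l => Polynomial.X - Polynomial.C (z l)), ← hTprod]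
    simp
  let γ₀ : MvPolynomial (Σ i : Fin n, Fin (lam i)) k →ₐ[k] T :=
    aeval fun p => (G p.1).coeff p.2
  have hγ₀P : P.map γ₀.toRingHom = Polynomial.X ^ ℓ := by
    rw [hP', Polynomial.map_prod, ← hGprod]
    refine Finset.prod_congr rfl fun i _ => ?_
    rw [map_monicOfCoeffs, ← hGcoeff i]
    simp [γ₀, hGcoeff]
  have hγ₀ : ∀ a ∈ IC, γ₀ a = 0 := by
    intro a ha
    have hle : IC ≤ RingHom.ker γ₀.toRingHom := by
      rw [hIC, Ideal.span_le]
      rintro _ ⟨d, hd, rfl⟩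
      have := congrArg (fun q => Polynomial.coeff q d) hγ₀P
      simpa [Polynomial.coeff_map, Polynomial.coeff_X_pow, hd.ne] using this
    exact hle ha
  let γ : (MvPolynomial (Σ i : Fin n, Fin (lam i)) k ⧸ IC) →ₐ[k] T :=
    Ideal.Quotient.liftₐ IC γ₀ hγ₀
  have hγX : ∀ i (j : Fin (lam i)), γ (mk (X ⟨i, j⟩)) = (G i).coeff j := fun i j => by
    change γ₀ (X ⟨i, j⟩) = _
    simp [γ₀]
  have : Nontrivial (MvPolynomial (Σ i : Fin n, Fin (lam i)) k ⧸ IC) :=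
    γ.toRingHom.domain_nontrivial
  obtain ⟨S, _, _, x, ⟨bS⟩, hS⟩ := exists_isUniversalSplitting F
    (fun i => monic_monicOfCoeffs _) (fun i => natDegree_monicOfCoeffs _) Finset.univ
  let _ : Algebra k S := ((algebraMap (MvPolynomial (Σ i : Fin n, Fin (lam i)) k ⧸ IC) S).comp
    (algebraMap k _)).toAlgebra
  obtain ⟨α, hα, hαz⟩ := hTlift S (algebraMap k S)
    (fun l => x (e.symm l).1 (e.symm l).2) (by
      rw [e.symm.prod_comp (fun p => Polynomial.X - Polynomial.C (x p.1 p.2)),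
        Fintype.prod_sigma, Polynomial.map_pow, Polynomial.map_X]
      rw [← Finset.prod_congr rfl hS.map_eq_prod, ← Polynomial.map_prod, hF]
      simp)
  obtain ⟨β, hβ, hβx⟩ := hS.exists_lift γ.toRingHom (fun i j => z (e ⟨i, j⟩)) (fun i _ => by
    change (F i).map γ.toRingHom = G i
    rw [map_monicOfCoeffs, ← hGcoeff i]
    congr 1
    exact funext (hγX i))
  have hβk : β.comp (algebraMap k S) = algebraMap k T := by
    change β.comp ((algebraMap _ S).comp (algebraMap k _)) = _
    rw [← RingHom.comp_assoc, hβ]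
    exact γ.comp_algebraMap
  have hβα : β.comp α = RingHom.id T := by
    refine hText T _ _ (by rw [RingHom.comp_assoc, hα, hβk, RingHom.id_comp]) fun l => ?_
    rw [RingHom.comp_apply, hαz, hβx _ (Finset.mem_univ _), Sigma.eta, Equiv.apply_symm_apply,
      RingHom.id_apply]
  have hαG : ∀ i, (G i).map α = (F i).map (algebraMap _ S) := fun i => by
    rw [hS.map_eq_prod i (Finset.mem_univ _), Polynomial.map_prod]
    refine Finset.prod_congr rfl fun j _ => ?_
    rw [Polynomial.map_sub, Polynomial.map_X, Polynomial.map_C, hαz, Equiv.symm_apply_apply]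
  have hαβ : α.comp β = RingHom.id S := by
    refine hS.hom_ext _ _ ?_ fun i hi j => ?_
    · rw [RingHom.comp_assoc, hβ, RingHom.id_comp]
      refine Ideal.Quotient.ringHom_ext (MvPolynomial.ringHom_ext ?_ ?_)
      · intro c
        change α (γ (algebraMap k _ c)) = algebraMap k S c
        rw [γ.commutes, ← hα, RingHom.comp_apply]
      · rintro ⟨i, j⟩
        change α (γ (mk (X ⟨i, j⟩))) = algebraMap _ S (mk (X ⟨i, j⟩))
        rw [hγX, ← Polynomial.coeff_map, hαG, Polynomial.coeff_map, coeff_monicOfCoeffs]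
    · rw [RingHom.comp_apply, hβx i hi, hαz, Equiv.symm_apply_apply, RingHom.id_apply]
  let E : T ≃ₐ[k] S := AlgEquiv.ofRingEquiv (f := RingEquiv.ofRingHom α β hαβ hβα)
    fun c => RingHom.congr_fun hα c
  have : FiniteDimensional k T := Module.Finite.of_basis bT
  have : FiniteDimensional k S := E.toLinearEquiv.finiteDimensional
  have hm : 0 < ∏ i, (lam i).factorial := Finset.prod_pos fun i _ => Nat.factorial_pos _
  obtain ⟨hfin, hrank⟩ := finiteDimensional_and_mul_finrank_eq
    (k := k) (A := MvPolynomial (Σ i : Fin n, Fin (lam i)) k ⧸ IC) rfl hm bS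
  refine ⟨hfin, ?_⟩
  rw [← E.toLinearEquiv.finrank_eq, Module.finrank_eq_card_basis bT, Fintype.card_fin] at hrank
  rw [← hrank, Nat.mul_div_cancel_left _ hm]
end

section
/- For all integers i, j with 1 ≤ i ≤ j ≤ ℓ, the complete homogeneous symmetric polynomial h_j(z_i, z_{i+1}, …, z_ℓ) of degree j in the variables z_i,…,z_ℓ (the sum of all monomials of total degree j in z_i,…,z_ℓ) belongs to I_S. -/
open MvPolynomial

/-- The complete homogeneous symmetric polynomial of degree `n` in the variables indexed
by `s`, splitting off the monomials that are divisible by `X a`. -/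
theorem Finset.sum_sym_insert_succ {σ R : Type*} [DecidableEq σ] [CommSemiring R] (f : σ → R)
    {s : Finset σ} {a : σ} (ha : a ∉ s) (n : ℕ) :
    ∑ m ∈ (insert a s).sym (n + 1), (m.1.map f).prod =
      ∑ m ∈ s.sym (n + 1), (m.1.map f).prod +
        f a * ∑ m ∈ (insert a s).sym n, (m.1.map f).prod := by
  rw [← Finset.sum_filter_not_add_sum_filter _ (fun m : Sym σ (n + 1) => a ∈ m)]
  congr 1
  · refine Finset.sum_congr ?_ fun _ _ => rfl
    ext m
    simp only [Finset.mem_filter, Finset.mem_sym_iff, Finset.mem_insert]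
    constructor
    · rintro ⟨h, ham⟩ b hb
      exact (h b hb).resolve_left fun hba => ham (hba ▸ hb)
    · exact fun h => ⟨fun b hb => Or.inr (h b hb), fun ham => ha (h a ham)⟩
  · rw [Finset.mul_sum]
    symm
    refine Finset.sum_bij (fun m _ => a ::ₛ m) ?_ ?_ ?_ ?_
    · intro m hm
      simp only [Finset.mem_filter, Finset.mem_sym_iff, Sym.mem_cons] at hm ⊢
      refine ⟨?_, by simp⟩
      rintro b (rfl | hb)
      · exact Finset.mem_insert_self _ _
      · exact hm b hb
    · intro m _ m' _ h
      exact Sym.cons_inj_right a m m' |>.1 h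
    · intro m hm
      simp only [Finset.mem_filter, Finset.mem_sym_iff] at hm
      refine ⟨m.erase a hm.2, ?_, Sym.cons_erase hm.2⟩
      exact Finset.mem_sym_iff.2 fun b hb => hm.1 b (Multiset.mem_of_mem_erase hb)
    · intro m _
      simp [Sym.coe_cons]

theorem MvPolynomial.rename_val_hsymm {σ R : Type*} [Fintype σ] [DecidableEq σ] [CommSemiring R]
    (p : σ → Prop) [DecidablePred p] (n : ℕ) :
    rename (Subtype.val : {t // p t} → σ) (hsymm {t // p t} R n) =
      ∑ m ∈ (Finset.univ.filter p).sym n, (m.1.map X).prod := by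
  rw [hsymm, map_sum]
  refine Finset.sum_bij (fun m _ => m.map Subtype.val) ?_ ?_ ?_ ?_
  · intro m _
    simp only [Finset.mem_sym_iff, Sym.mem_map, Finset.mem_filter, Finset.mem_univ, true_and]
    rintro _ ⟨b, _, rfl⟩
    exact b.2
  · intro m _ m' _ h
    exact Sym.map_injective Subtype.val_injective n h
  · intro m hm
    have h : ∀ b ∈ m, p b := fun b hb =>
      (Finset.mem_filter.1 (Finset.mem_sym_iff.1 hm b hb)).2
    refine ⟨m.attach.map fun b => ⟨b.1, h b.1 b.2⟩, Finset.mem_univ _, ?_⟩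
    rw [Sym.map_map]
    exact Sym.attach_map_coe m
  · intro m _
    simp [map_multiset_prod, Multiset.map_map]

theorem MvPolynomial.constantCoeff_hsymm {σ R : Type*} [Fintype σ] [DecidableEq σ]
    [CommSemiring R] {n : ℕ} (hn : n ≠ 0) : constantCoeff (hsymm σ R n) = 0 := by
  rw [hsymm, map_sum]
  refine Finset.sum_eq_zero fun m _ => ?_
  obtain ⟨n, rfl⟩ := Nat.exists_eq_succ_of_ne_zero hn
  obtain ⟨a, m, rfl⟩ := m.exists_eq_cons_of_succ
  simp [Sym.coe_cons]

theorem sum_sym_tail_mem_span_symmetric (R : Type*) [CommRing R] (ℓ i : ℕ) :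
    ∀ j, i < j →
      ∑ m ∈ (Finset.univ.filter fun t : Fin ℓ => i ≤ (t : ℕ)).sym j,
          (m.1.map (X : Fin ℓ → MvPolynomial (Fin ℓ) R)).prod ∈
        Ideal.span {p : MvPolynomial (Fin ℓ) R | p.IsSymmetric ∧ constantCoeff p = 0} := by
  induction i with
  | zero =>
    intro j hj
    refine Ideal.subset_span ?_
    have : ∑ m ∈ (Finset.univ.filter fun t : Fin ℓ => 0 ≤ (t : ℕ)).sym j,
        (m.1.map (X : Fin ℓ → MvPolynomial (Fin ℓ) R)).prod = hsymm (Fin ℓ) R j := by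
      simp [hsymm]
    rw [this]
    exact ⟨hsymm_isSymmetric _ _ _, constantCoeff_hsymm hj.ne'⟩
  | succ i ih =>
    intro j hj
    by_cases hi : i < ℓ
    · obtain ⟨j, rfl⟩ := Nat.exists_eq_succ_of_ne_zero (Nat.ne_zero_of_lt hj)
      have hins : (Finset.univ.filter fun t : Fin ℓ => i ≤ (t : ℕ)) =
          insert ⟨i, hi⟩ (Finset.univ.filter fun t : Fin ℓ => i + 1 ≤ (t : ℕ)) := by
        ext t
        simp only [Finset.mem_filter, Finset.mem_univ, true_and, Finset.mem_insert, Fin.ext_iff]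
        omega
      have h₁ := ih (j + 1) (by omega)
      have h₀ := ih j (by omega)
      rw [hins] at h₀ h₁
      rw [Finset.sum_sym_insert_succ _ (by simp)] at h₁
      exact (Ideal.add_mem_iff_left _ (Ideal.mul_mem_left _ _ h₀)).1 h₁
    · have hfilter : (Finset.univ.filter fun t : Fin ℓ => i + 1 ≤ (t : ℕ)) =
          Finset.univ.filter fun t : Fin ℓ => i ≤ (t : ℕ) := by
        ext t
        simp only [Finset.mem_filter, Finset.mem_univ, true_and]
        omega
      rw [hfilter]
      exact ih j (by omega)

/-- Let `k` be a field of characteristic zero and `ℓ ≥ 1`.  For all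
`1 ≤ i ≤ j ≤ ℓ`, the complete homogeneous symmetric polynomial of degree `j` in the
variables `z_i, z_{i+1}, …, z_ℓ` (with the 1-based variable `z_s` being `X ⟨s-1,_⟩` of
`MvPolynomial (Fin ℓ) k`) belongs to the ideal `I_S` generated by all symmetric
polynomials in `z_1,…,z_ℓ` with zero constant term. -/
theorem hsymm_tail_mem_symmetric_ideal
    (k : Type*) [Field k] [CharZero k] (ℓ i j : ℕ)
    (hi : 1 ≤ i) (hij : i ≤ j) (hj : j ≤ ℓ) :
    rename (Subtype.val : {t : Fin ℓ // i - 1 ≤ (t : ℕ)} → Fin ℓ)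
        (hsymm {t : Fin ℓ // i - 1 ≤ (t : ℕ)} k j) ∈
      Ideal.span {p : MvPolynomial (Fin ℓ) k | p.IsSymmetric ∧ constantCoeff p = 0} := by
  rw [rename_val_hsymm]
  exact sum_sym_tail_mem_span_symmetric k ℓ (i - 1) j (by omega)
end
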